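/- arXiv:2207.07398 — 2 statements merged into one kernel-verified Lean document; each statement's English description precedes it below -/
import Mathlib

section
/- Let q ∈ (0,∞) with q ≠ 1 and r ∈ (0,4]. If r·log(q) = q − 1 and q ≤ 3, then the fixed point 0 of Φ_{q,r} = φ_q ∘ f_r is locally asymptotically stable. -/
open Real Set Filter

/-- The q-deformation φ_q(x) = (1 - q^x)/(1 - q). -/
noncomputable def phi (q x : ℝ) : ℝ := (1 - q ^ x) / (1 - q)

/-- The logistic map f_r(x) = r·x·(1-x). -/
noncomputable def logistic (r x : ℝ) : ℝ := r * x * (1 - x)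

/-- The q-deformed logistic map Φ_{q,r} = φ_q ∘ f_r. -/
noncomputable def Phi (q r x : ℝ) : ℝ := phi q (logistic r x)

/-- A fixed point `x₀` of `g : [0,1] → [0,1]` is locally asymptotically stable:
(i) for every `ε > 0` there is a neighborhood `V` of `x₀` in `[0,1]` with
`|gⁿ(x) - x₀| < ε` for all `x ∈ V` and all `n`; (ii) there is a neighborhood `V` of `x₀`
in `[0,1]` such that `gⁿ(x) → x₀` for all `x ∈ V`. -/
def LAS (g : ℝ → ℝ) (x₀ : ℝ) : Prop :=
  (∀ ε > 0, ∃ V ∈ nhdsWithin x₀ (Set.Icc (0:ℝ) 1),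
    ∀ x ∈ V ∩ Set.Icc (0:ℝ) 1, ∀ n : ℕ, |g^[n] x - x₀| < ε) ∧
  (∃ V ∈ nhdsWithin x₀ (Set.Icc (0:ℝ) 1),
    ∀ x ∈ V ∩ Set.Icc (0:ℝ) 1,
      Filter.Tendsto (fun n : ℕ => g^[n] x) Filter.atTop (nhds x₀))

lemma sub_sq_half_lt_log_one_add {u : ℝ} (hu : 0 < u) : u - u ^ 2 / 2 < Real.log (1 + u) := by
  refine lt_of_lt_of_le ?_ (Real.le_log_one_add_of_nonneg hu.le)
  rw [lt_div_iff₀ (by linarith)]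
  nlinarith [pow_pos hu 3]

lemma phi_nonneg {q t : ℝ} (hq : 0 < q) (hq1 : q ≠ 1) (ht : 0 ≤ t) : 0 ≤ phi q t := by
  unfold phi
  rcases lt_or_gt_of_ne hq1 with h | h
  · exact div_nonneg (sub_nonneg.2 (Real.rpow_le_one hq.le h.le ht)) (by linarith)
  · exact div_nonneg_of_nonpos (sub_nonpos.2 (Real.one_le_rpow h.le ht)) (by linarith)

lemma Phi_nonneg {q r x : ℝ} (hq : 0 < q) (hq1 : q ≠ 1) (hr : 0 < r) (hx0 : 0 ≤ x)
    (hx1 : x ≤ 1) : 0 ≤ Phi q r x :=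
  phi_nonneg hq hq1 (mul_nonneg (mul_nonneg hr.le hx0) (by linarith))

lemma Phi_zero (q r : ℝ) : Phi q r 0 = 0 := by
  simp [Phi, phi, logistic]

lemma continuous_Phi {q : ℝ} (hq : 0 < q) (r : ℝ) : Continuous (Phi q r) := by
  unfold Phi phi logistic
  refine Continuous.div_const (continuous_const.sub ?_) _
  exact Continuous.rpow continuous_const (by fun_prop) fun _ => Or.inl hq.ne'

lemma Phi_lt_self {q r x : ℝ} (hq : 0 < q) (hq1 : q ≠ 1) (heq : r * Real.log q = q - 1)
    (hq3 : q ≤ 3) (hx0 : 0 < x) (hx1 : x ≤ 1) : Phi q r x < x := by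
  have hexp : q ^ logistic r x = Real.exp ((q - 1) * x * (1 - x)) := by
    rw [Real.rpow_def_of_pos hq, ← heq, logistic]
    ring_nf
  have hpos : 0 < 1 + (q - 1) * x := by nlinarith
  unfold Phi phi
  rw [hexp]
  rcases lt_or_gt_of_ne hq1 with h | h
  · rw [div_lt_iff₀ (by linarith)]
    have hu : (q - 1) * x < 0 := mul_neg_of_neg_of_pos (by linarith) hx0
    have h1 : (q - 1) * x * (1 - x) + 1 ≤ Real.exp ((q - 1) * x * (1 - x)) :=
      Real.add_one_le_exp _
    nlinarith
  · rw [div_lt_iff_of_neg (by linarith)]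
    have hu : 0 < (q - 1) * x := mul_pos (by linarith) hx0
    have h1 : (q - 1) * x * (1 - x) < Real.log (1 + (q - 1) * x) := by
      refine lt_of_le_of_lt ?_ (sub_sq_half_lt_log_one_add hu)
      nlinarith [mul_pos hu hx0]
    have h2 := (Real.lt_log_iff_exp_lt hpos).1 h1
    linarith

/-- A continuous self-map of `[0, 1]` fixing `0` and lying strictly below the diagonal on `(0, 1]`
has `0` as a locally asymptotically stable fixed point. -/
lemma LAS_zero_of_lt_self {g : ℝ → ℝ} (hg : Continuous g) (hg0 : g 0 = 0)
    (hnonneg : ∀ x, 0 ≤ x → x ≤ 1 → 0 ≤ g x) (hlt : ∀ x, 0 < x → x ≤ 1 → g x < x) :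
    LAS g 0 := by
  have hle : ∀ x, 0 ≤ x → x ≤ 1 → g x ≤ x := by
    intro x hx0 hx1
    rcases hx0.eq_or_lt with rfl | hx
    · exact hg0.le
    · exact (hlt x hx hx1).le
  have hmem : ∀ x ∈ Set.Icc (0 : ℝ) 1, ∀ n : ℕ, 0 ≤ g^[n] x ∧ g^[n] x ≤ x := by
    intro x hx n
    induction n with
    | zero => exact ⟨hx.1, le_rfl⟩
    | succ n ih =>
      rw [Function.iterate_succ_apply']
      have h1 := ih.2.trans hx.2
      exact ⟨hnonneg _ ih.1 h1, (hle _ ih.1 h1).trans ih.2⟩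
  refine ⟨fun ε hε => ⟨Set.Iio ε, mem_nhdsWithin_of_mem_nhds (Iio_mem_nhds hε), ?_⟩,
    Set.univ, Filter.univ_mem, ?_⟩
  · rintro x ⟨hxε, hx⟩ n
    obtain ⟨h0, h1⟩ := hmem x hx n
    rw [sub_zero, abs_of_nonneg h0]
    exact h1.trans_lt hxε
  · rintro x ⟨-, hx⟩
    have hanti : Antitone fun n : ℕ => g^[n] x := by
      refine antitone_nat_of_succ_le fun n => ?_
      rw [Function.iterate_succ_apply']
      exact hle _ (hmem x hx n).1 ((hmem x hx n).2.trans hx.2)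
    have hlim := tendsto_atTop_ciInf hanti ⟨0, by rintro _ ⟨n, rfl⟩; exact (hmem x hx n).1⟩
    set l := ⨅ n : ℕ, g^[n] x
    have hl0 : 0 ≤ l := ge_of_tendsto' hlim fun n => (hmem x hx n).1
    have hl1 : l ≤ 1 := le_of_tendsto' hlim fun n => (hmem x hx n).2.trans hx.2
    have hfix : g l = l := isFixedPt_of_tendsto_iterate hlim hg.continuousAt
    rcases hl0.eq_or_lt with h | h
    · rwa [← h] at hlim
    · exact absurd hfix (hlt l h hl1).ne

/-- If `r·log q = q - 1` and `q ≤ 3`, the fixed point `0` of `Φ_{q,r}` is locally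
asymptotically stable. -/
theorem stmt_9 (q r : ℝ) (hq : 0 < q) (hq1 : q ≠ 1) (hr : 0 < r) (hr4 : r ≤ 4)
    (heq : r * Real.log q = q - 1) (hq3 : q ≤ 3) :
    LAS (Phi q r) 0 := by
  exact LAS_zero_of_lt_self (continuous_Phi hq r) (Phi_zero q r)
    (fun _ => Phi_nonneg hq hq1 hr) (fun _ => Phi_lt_self hq hq1 heq hq3)
end

section
/- For every q ∈ (0,∞) with q ≠ 1, the topological entropy of the q-deformed logistic map Φ_{q,4} = φ_q ∘ f_4 : [0,1] → [0,1] equals log 2. -/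
open Real Set Filter

/-- A symmetric full unimodal map `f` of `[0,1]`, together with the inverse `g` of its increasing
branch. -/
structure IsFold (f g : ℝ → ℝ) : Prop where
  continuousOn : ContinuousOn f (Icc 0 1)
  symm : ∀ x, f (1 - x) = f x
  mapsTo : MapsTo f (Icc 0 1) (Icc 0 1)
  inv_mapsTo : MapsTo g (Icc 0 1) (Icc 0 (1 / 2))
  inv_strictMonoOn : StrictMonoOn g (Icc 0 1)
  right_inv : ∀ y ∈ Icc (0 : ℝ) 1, f (g y) = y
  left_inv : ∀ x ∈ Icc (0 : ℝ) (1 / 2), g (f x) = x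
  inv_one : g 1 = 1 / 2

theorem exists_isFold {f : ℝ → ℝ} (hc : ContinuousOn f (Icc 0 1)) (hs : ∀ x, f (1 - x) = f x)
    (hm : StrictMonoOn f (Icc 0 (1 / 2))) (h0 : f 0 = 0) (h1 : f (1 / 2) = 1) :
    ∃ g, IsFold f g := by
  have hsurj : ∀ y ∈ Icc (0 : ℝ) 1, ∃ x ∈ Icc (0 : ℝ) (1 / 2), f x = y := by
    intro y hy
    have := intermediate_value_Icc (by norm_num : (0 : ℝ) ≤ 1 / 2)
      (hc.mono (Icc_subset_Icc_right (by norm_num)))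
    rw [h0, h1] at this
    exact this hy
  have hl : MapsTo f (Icc 0 (1 / 2)) (Icc 0 1) := fun x hx ↦
    ⟨h0 ▸ hm.monotoneOn ⟨le_rfl, by norm_num⟩ hx hx.1,
      h1 ▸ hm.monotoneOn hx ⟨by norm_num, le_rfl⟩ hx.2⟩
  choose! g hg hfg using hsurj
  have hgf : ∀ x ∈ Icc (0 : ℝ) (1 / 2), g (f x) = x := fun x hx ↦
    hm.injOn (hg _ (hl hx)) hx (hfg _ (hl hx))
  refine ⟨g, hc, hs, fun x hx ↦ ?_, hg, fun a ha b hb hab ↦ ?_, hfg, hgf, ?_⟩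
  · rcases le_total x (1 / 2) with h | h
    · exact hl ⟨hx.1, h⟩
    · rw [← hs]
      exact hl ⟨by linarith [hx.2], by linarith⟩
  · rwa [← hm.lt_iff_lt (hg a ha) (hg b hb), hfg a ha, hfg b hb]
  · have := hgf (1 / 2) ⟨by norm_num, le_rfl⟩
    rwa [h1] at this

namespace IsFold

variable {f g : ℝ → ℝ}

theorem iterate_mapsTo (h : IsFold f g) (k : ℕ) : MapsTo f^[k] (Icc 0 1) (Icc 0 1) :=
  h.mapsTo.iterate k

theorem iterate_continuousOn (h : IsFold f g) (k : ℕ) : ContinuousOn f^[k] (Icc 0 1) :=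
  h.continuousOn.iterate h.mapsTo k

theorem eq_inv_or (h : IsFold f g) {x : ℝ} (hx : x ∈ Icc (0 : ℝ) 1) :
    g (f x) = x ∨ 1 - g (f x) = x := by
  rcases le_total x (1 / 2) with hx' | hx'
  · exact .inl (h.left_inv x ⟨hx.1, hx'⟩)
  · have := h.left_inv (1 - x) ⟨by linarith [hx.2], by linarith⟩
    rw [h.symm] at this
    right
    linarith

theorem right_inv' (h : IsFold f g) {y : ℝ} (hy : y ∈ Icc (0 : ℝ) 1) : f (1 - g y) = y := by
  rw [h.symm, h.right_inv y hy]

/-! ### Upper bound -/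

/-- The points of `[0,1]` which `f` sends into `P` in at most `n` steps lie in a finite set of at
most `(2 ^ (n + 1) - 1) * P.card` elements. -/
theorem exists_preimages (h : IsFold f g) (P : Finset ℝ) (n : ℕ) :
    ∃ Q : Finset ℝ, Q.card + P.card ≤ P.card * 2 ^ (n + 1) ∧
      ∀ k ≤ n, ∀ x ∈ Icc (0 : ℝ) 1, f^[k] x ∈ P → x ∈ Q := by
  classical
  induction n with
  | zero =>
    refine ⟨P, by omega, fun k hk x _ hx ↦ ?_⟩
    obtain rfl : k = 0 := by omega
    exact hx
  | succ n ih =>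
    obtain ⟨Q, hQ, hmem⟩ := ih
    refine ⟨P ∪ (Q.image g ∪ Q.image (fun y ↦ 1 - g y)), ?_, fun k hk x hx hxP ↦ ?_⟩
    · have h1 := Finset.card_union_le P (Q.image g ∪ Q.image (fun y ↦ 1 - g y))
      have h2 := Finset.card_union_le (Q.image g) (Q.image (fun y ↦ 1 - g y))
      have h3 := Finset.card_image_le (s := Q) (f := g)
      have h4 := Finset.card_image_le (s := Q) (f := fun y ↦ 1 - g y)
      have h5 : P.card * 2 ^ (n + 1 + 1) = 2 * (P.card * 2 ^ (n + 1)) := by ring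
      omega
    · rcases k with _ | k
      · exact Finset.mem_union_left _ hxP
      · have hfx : f x ∈ Q := hmem k (by omega) _ (h.mapsTo hx) (by simpa using hxP)
        refine Finset.mem_union_right _ (Finset.mem_union.2 ?_)
        rcases h.eq_inv_or hx with hx' | hx'
        · exact .inl (Finset.mem_image.2 ⟨_, hfx, hx'⟩)
        · exact .inr (Finset.mem_image.2 ⟨_, hfx, hx'⟩)

end IsFold

theorem exists_grid_mem {m : ℕ} (hm : 0 < m) {u v : ℝ} (hu : 0 ≤ u) (hv : v ≤ 1)
    (huv : 1 / (m : ℝ) < v - u) :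
    ∃ p ∈ (Finset.range (m + 1)).image (fun j : ℕ ↦ (j : ℝ) / m), u < p ∧ p < v := by
  have hm' : (0 : ℝ) < m := by exact_mod_cast hm
  have hlt : (⌊m * u⌋₊ : ℝ) + 1 < m * v := by
    have h1 := Nat.floor_le (mul_nonneg hm'.le hu)
    rw [div_lt_iff₀ hm'] at huv
    nlinarith
  have hpv : ((⌊m * u⌋₊ + 1 : ℕ) : ℝ) / m < v := by
    rw [div_lt_iff₀ hm']
    push_cast
    linarith
  refine ⟨_, Finset.mem_image.2 ⟨⌊m * u⌋₊ + 1, Finset.mem_range.2 ?_, rfl⟩, ?_, hpv⟩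
  · have : ((⌊m * u⌋₊ + 1 : ℕ) : ℝ) < m := by
      have := hpv.trans_le hv
      rwa [div_lt_one hm'] at this
    have : ⌊m * u⌋₊ + 1 < m := by exact_mod_cast this
    omega
  · rw [lt_div_iff₀ hm']
    push_cast
    linarith [Nat.lt_floor_add_one (m * u)]

namespace IsFold

variable {f g : ℝ → ℝ}

open Dynamics in
theorem coverMincard_le (h : IsFold f g) {m : ℕ} (hm : 0 < m) {ε : ℝ} (hε : 1 / (m : ℝ) < ε)
    (n : ℕ) :
    coverMincard f (Icc 0 1) {p | dist p.1 p.2 < ε} n ≤ ((2 * (m + 1) * 2 ^ n : ℕ) : ℕ∞) := by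
  classical
  set P := (Finset.range (m + 1)).image (fun j : ℕ ↦ (j : ℝ) / m)
  obtain ⟨Q, hQ, hmem⟩ := h.exists_preimages P n
  have hcover : IsDynCoverOf f (Icc 0 1) {p : ℝ × ℝ | dist p.1 p.2 < ε} n Q := by
    intro x hx
    have hne : (Q.filter (fun y ↦ y ∈ Icc 0 x)).Nonempty := by
      refine ⟨0, Finset.mem_filter.2 ⟨hmem 0 (Nat.zero_le _) 0 (by simp) ?_, le_rfl, hx.1⟩⟩
      exact Finset.mem_image.2 ⟨0, by simp, by simp⟩
    obtain ⟨y, hy, hmax⟩ := Finset.exists_max_image _ id hne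
    obtain ⟨hyQ, hy0, hyx⟩ := Finset.mem_filter.1 hy
    have hy1 : y ∈ Icc (0 : ℝ) 1 := ⟨hy0, hyx.trans hx.2⟩
    have hno : ∀ k < n, ∀ t ∈ Icc y x, f^[k] t ∈ P → f^[k] t = f^[k] y := by
      intro k hk t ht htP
      have htQ := hmem k hk.le t ⟨hy0.trans ht.1, ht.2.trans hx.2⟩ htP
      have := hmax t (Finset.mem_filter.2 ⟨htQ, hy0.trans ht.1, ht.2⟩)
      rw [show t = y from le_antisymm this ht.1]
    have hcl : ∀ k < n, dist (f^[k] x) (f^[k] y) < ε := by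
      intro k hk
      by_contra! hcon
      have hc : ContinuousOn f^[k] (Icc y x) :=
        (h.iterate_continuousOn k).mono (Icc_subset_Icc hy0 hx.2)
      have hfx := h.iterate_mapsTo k hx
      have hfy := h.iterate_mapsTo k hy1
      rw [Real.dist_eq] at hcon
      rcases le_total (f^[k] x) (f^[k] y) with hle | hle
      · rw [abs_of_nonpos (by linarith)] at hcon
        obtain ⟨p, hp, hp1, hp2⟩ := exists_grid_mem hm hfx.1 hfy.2 (by linarith)
        obtain ⟨t, ht, rfl⟩ := intermediate_value_Icc' hyx hc ⟨hp1.le, hp2.le⟩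
        exact hp2.ne (hno k hk t ht hp)
      · rw [abs_of_nonneg (by linarith)] at hcon
        obtain ⟨p, hp, hp1, hp2⟩ := exists_grid_mem hm hfy.1 hfx.2 (by linarith)
        obtain ⟨t, ht, rfl⟩ := intermediate_value_Icc hyx hc ⟨hp1.le, hp2.le⟩
        exact hp1.ne' (hno k hk t ht hp)
    exact ⟨y, hyQ, mem_dynEntourage.2 hcl⟩
  refine hcover.coverMincard_le_card.trans (Nat.cast_le.2 ?_)
  have hPc : P.card ≤ m + 1 := Finset.card_image_le.trans (by simp)
  calc Q.card ≤ P.card * 2 ^ (n + 1) := by omega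
    _ ≤ (m + 1) * 2 ^ (n + 1) := Nat.mul_le_mul_right _ hPc
    _ = 2 * (m + 1) * 2 ^ n := by ring

open Dynamics in
theorem coverEntropy_le (h : IsFold f g) :
    coverEntropy f (Icc 0 1) ≤ ENNReal.log 2 := by
  rw [coverEntropy_eq_iSup_basis Metric.uniformity_basis_dist]
  refine iSup₂_le fun ε hε ↦ ?_
  obtain ⟨m, hm⟩ := exists_nat_one_div_lt hε
  rw [← ExpGrowth.expGrowthSup_pow, coverEntropyEntourage]
  refine ExpGrowth.expGrowthSup_le_of_eventually_le (b := ((2 * (m + 1 + 1) : ℕ) : ENNReal))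
    (ENNReal.natCast_ne_top _) (Eventually.of_forall fun n ↦ ?_)
  have := ENat.toENNReal_mono (h.coverMincard_le (Nat.succ_pos m) (by exact_mod_cast hm) n)
  refine this.trans_eq ?_
  push_cast
  rfl

end IsFold

/-! ### Lower bound -/

/-- The points of the finite set `A` are `ε`-separated by `f` before time `n`. -/
def IsOrbitSeparated (f : ℝ → ℝ) (ε : ℝ) (n : ℕ) (A : Finset ℝ) : Prop :=
  ∀ x ∈ A, ∀ y ∈ A, x ≠ y → ∃ k < n, ε ≤ dist (f^[k] x) (f^[k] y)

open Dynamics in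
theorem IsOrbitSeparated.card_le_netMaxcard {f : ℝ → ℝ} {ε : ℝ} {n : ℕ} {A : Finset ℝ}
    {F : Set ℝ} (hA : IsOrbitSeparated f ε n A) (hF : ↑A ⊆ F) :
    (A.card : ℕ∞) ≤ netMaxcard f F {p | dist p.1 p.2 < ε / 2} n := by
  refine IsDynNetIn.card_le_netMaxcard ⟨hF, fun x hx y hy hxy ↦ ?_⟩
  refine Set.disjoint_left.2 fun z hzx hzy ↦ ?_
  obtain ⟨k, hk, hd⟩ := hA x hx y hy hxy
  have h1 : dist (f^[k] x) (f^[k] z) < ε / 2 := mem_ball_dynEntourage.1 hzx k hk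
  have h2 : dist (f^[k] y) (f^[k] z) < ε / 2 := mem_ball_dynEntourage.1 hzy k hk
  have h3 := dist_triangle_right (f^[k] x) (f^[k] y) (f^[k] z)
  linarith

namespace IsFold

variable {f g : ℝ → ℝ}

/-- Pulling a separated set back along the decreasing branch. -/
theorem exists_separated_succ (h : IsFold f g) {a ε : ℝ} {n : ℕ} {A : Finset ℝ}
    (ha : 0 ≤ a) (ha1 : a ≤ 1) (hA : ↑A ⊆ Icc a 1) (hsep : IsOrbitSeparated f ε n A) :
    ∃ B : Finset ℝ, B.card = A.card ∧ ↑B ⊆ Icc (1 / 2) (1 - g a) ∧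
      IsOrbitSeparated f ε (n + 1) B := by
  classical
  have hA' : ∀ x ∈ A, x ∈ Icc (0 : ℝ) 1 := fun x hx ↦ ⟨ha.trans (hA hx).1, (hA hx).2⟩
  refine ⟨A.image (fun y ↦ 1 - g y), Finset.card_image_of_injOn fun x hx y hy hxy ↦ ?_, ?_, ?_⟩
  · rw [← h.right_inv' (hA' x hx), ← h.right_inv' (hA' y hy)]
    exact congrArg f hxy
  · intro z hz
    obtain ⟨x, hx, rfl⟩ := Finset.mem_image.1 hz
    have h1 := h.inv_strictMonoOn.monotoneOn ⟨ha, ha1⟩ (hA' x hx) (hA hx).1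
    have h2 := (h.inv_mapsTo (hA' x hx)).2
    exact ⟨by linarith, by linarith⟩
  · intro z hz w hw hzw
    obtain ⟨x, hx, rfl⟩ := Finset.mem_image.1 hz
    obtain ⟨y, hy, rfl⟩ := Finset.mem_image.1 hw
    obtain ⟨k, hk, hd⟩ := hsep x hx y hy (fun e ↦ hzw (by rw [e]))
    refine ⟨k + 1, by omega, ?_⟩
    simpa only [Function.iterate_succ_apply, h.right_inv' (hA' x hx),
      h.right_inv' (hA' y hy)] using hd

/-- Pulling a separated set that stays away from `1` back along both branches. -/
theorem exists_separated_double (h : IsFold f g) {a η ε : ℝ} {n : ℕ} {A : Finset ℝ}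
    (ha : 0 ≤ a) (ha1 : a ≤ 1) (hη : 0 ≤ η) (hη1 : η < 1) (hε : 0 < ε)
    (hεη : ε ≤ 1 - 2 * g (1 - η)) (hA : ↑A ⊆ Icc a (1 - η)) (hsep : IsOrbitSeparated f ε n A) :
    ∃ B : Finset ℝ, B.card = 2 * A.card ∧ ↑B ⊆ Icc (g a) (1 - g a) ∧
      IsOrbitSeparated f ε (n + 1) B := by
  classical
  have hA' : ∀ x ∈ A, x ∈ Icc (0 : ℝ) 1 := fun x hx ↦
    ⟨ha.trans (hA hx).1, by linarith [(hA hx).2]⟩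
  have hlow : ∀ x ∈ A, g a ≤ g x := fun x hx ↦
    h.inv_strictMonoOn.monotoneOn ⟨ha, ha1⟩ (hA' x hx) (hA hx).1
  have hup : ∀ x ∈ A, g x ≤ g (1 - η) := fun x hx ↦
    h.inv_strictMonoOn.monotoneOn (hA' x hx) ⟨by linarith, by linarith⟩ (hA hx).2
  have hhalf : ∀ x ∈ A, g x ≤ 1 / 2 := fun x hx ↦ (h.inv_mapsTo (hA' x hx)).2
  have hgap : ∀ x ∈ A, ∀ y ∈ A, ε ≤ (1 - g y) - g x := fun x hx y hy ↦ by
    linarith [hup x hx, hup y hy]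
  have hinj₁ : InjOn g A := fun x hx y hy hxy ↦ by
    rw [← h.right_inv x (hA' x hx), ← h.right_inv y (hA' y hy), hxy]
  have hinj₂ : InjOn (fun y ↦ 1 - g y) A := fun x hx y hy hxy ↦
    hinj₁ hx hy (sub_right_injective hxy)
  refine ⟨A.image g ∪ A.image (fun y ↦ 1 - g y), ?_, ?_, ?_⟩
  · rw [Finset.card_union_of_disjoint, Finset.card_image_of_injOn hinj₁,
      Finset.card_image_of_injOn hinj₂, two_mul]
    refine Finset.disjoint_left.2 fun z hz hz' ↦ ?_
    obtain ⟨x, hx, rfl⟩ := Finset.mem_image.1 hz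
    obtain ⟨y, hy, hxy⟩ := Finset.mem_image.1 hz'
    have := hgap x hx y hy
    linarith
  · intro z hz
    rcases Finset.mem_union.1 hz with hz | hz
    · obtain ⟨x, hx, rfl⟩ := Finset.mem_image.1 hz
      exact ⟨hlow x hx, by linarith [hlow x hx, hhalf x hx]⟩
    · obtain ⟨x, hx, rfl⟩ := Finset.mem_image.1 hz
      exact ⟨by linarith [hlow x hx, hhalf x hx], by linarith [hlow x hx]⟩
  · have hstep : ∀ x ∈ A, ∀ y ∈ A, ∀ z w, f z = x → f w = y → x ≠ y →
        ∃ k < n + 1, ε ≤ dist (f^[k] z) (f^[k] w) := by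
      rintro x hx y hy z w rfl rfl hne
      obtain ⟨k, hk, hd⟩ := hsep _ hx _ hy hne
      exact ⟨k + 1, by omega, hd⟩
    have hfar : ∀ x ∈ A, ∀ y ∈ A, ε ≤ dist (g x) (1 - g y) := fun x hx y hy ↦ by
      rw [dist_comm, Real.dist_eq]
      exact (hgap x hx y hy).trans (le_abs_self _)
    intro z hz w hw hzw
    rcases Finset.mem_union.1 hz with hz | hz <;> rcases Finset.mem_union.1 hw with hw | hw <;>
      obtain ⟨x, hx, rfl⟩ := Finset.mem_image.1 hz <;>
      obtain ⟨y, hy, rfl⟩ := Finset.mem_image.1 hw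
    · exact hstep x hx y hy _ _ (h.right_inv x (hA' x hx)) (h.right_inv y (hA' y hy))
        (fun e ↦ hzw (by rw [e]))
    · exact ⟨0, by omega, hfar x hx y hy⟩
    · exact ⟨0, by omega, by rw [dist_comm]; exact hfar y hy x hx⟩
    · exact hstep x hx y hy _ _ (h.right_inv' (hA' x hx)) (h.right_inv' (hA' y hy))
        (fun e ↦ hzw (by simp only [e]))

theorem inv_iterate_mem (h : IsFold f g) (j : ℕ) : g^[j] (1 / 2) ∈ Ioc (0 : ℝ) (1 / 2) := by
  induction j with
  | zero => norm_num
  | succ j ih =>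
    rw [Function.iterate_succ_apply']
    have hj : g^[j] (1 / 2) ∈ Icc (0 : ℝ) 1 := ⟨ih.1.le, by linarith [ih.2]⟩
    exact ⟨(h.inv_mapsTo ⟨le_rfl, zero_le_one⟩).1.trans_lt
      (h.inv_strictMonoOn ⟨le_rfl, zero_le_one⟩ hj ih.1), (h.inv_mapsTo hj).2⟩

/-- Along a block of length `M + 1`, the number of separated points is multiplied by `2 ^ M`. -/
theorem exists_separated (h : IsFold f g) (M : ℕ) :
    ∃ ε > 0, ∀ k : ℕ, ∃ A : Finset ℝ, A.card = (2 ^ M) ^ k ∧ ↑A ⊆ Icc (0 : ℝ) 1 ∧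
      IsOrbitSeparated f ε ((M + 1) * k) A := by
  obtain ⟨j₀, hj₀, hmin⟩ := Finset.exists_min_image (Finset.range (M + 2))
    (fun j ↦ g^[j] (1 / 2)) ⟨0, by simp⟩
  set η := g^[j₀] (1 / 2)
  obtain ⟨hη0, hη1⟩ : 0 < η ∧ η ≤ 1 / 2 := h.inv_iterate_mem j₀
  have hε : 0 < 1 - 2 * g (1 - η) := by
    have := h.inv_strictMonoOn (a := 1 - η) (b := 1) ⟨by linarith, by linarith⟩ (by simp)
      (by linarith)
    rw [h.inv_one] at this
    linarith
  refine ⟨1 - 2 * g (1 - η), hε, fun k ↦ ?_⟩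
  suffices H : ∃ A : Finset ℝ, A.card = (2 ^ M) ^ k ∧ ↑A ⊆ Icc (1 / 2 : ℝ) (1 - η) ∧
      IsOrbitSeparated f (1 - 2 * g (1 - η)) ((M + 1) * k) A by
    obtain ⟨A, hc, hA, hs⟩ := H
    exact ⟨A, hc, hA.trans (Icc_subset_Icc (by norm_num) (by linarith)), hs⟩
  induction k with
  | zero =>
    refine ⟨{1 / 2}, by simp, ?_, ?_⟩
    · simp only [Finset.coe_singleton, singleton_subset_iff, mem_Icc]
      exact ⟨le_rfl, by linarith⟩
    · intro x hx y hy hxy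
      exact absurd ((Finset.mem_singleton.1 hx).trans (Finset.mem_singleton.1 hy).symm) hxy
  | succ k ih =>
    have hblock : ∀ j ≤ M, ∃ A : Finset ℝ, A.card = 2 ^ j * (2 ^ M) ^ k ∧
        ↑A ⊆ Icc (g^[j] (1 / 2)) (1 - η) ∧
        IsOrbitSeparated f (1 - 2 * g (1 - η)) ((M + 1) * k + j) A := by
      intro j hj
      induction j with
      | zero => simpa using ih
      | succ j ihj =>
        obtain ⟨A, hc, hA, hs⟩ := ihj (by omega)
        have hmem := h.inv_iterate_mem j
        obtain ⟨B, hcB, hB, hsB⟩ := h.exists_separated_double hmem.1.le (by linarith [hmem.2])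
          hη0.le (by linarith) hε le_rfl hA hs
        rw [← Function.iterate_succ_apply' g j] at hB
        refine ⟨B, by rw [hcB, hc]; ring, hB.trans (Icc_subset_Icc_right ?_), hsB⟩
        have := hmin (j + 1) (Finset.mem_range.2 (by omega))
        linarith
    obtain ⟨A, hc, hA, hs⟩ := hblock M le_rfl
    have hmem := h.inv_iterate_mem M
    obtain ⟨B, hcB, hB, hsB⟩ := h.exists_separated_succ hmem.1.le (by linarith [hmem.2])
      (hA.trans (Icc_subset_Icc_right (by linarith))) hs
    rw [← Function.iterate_succ_apply' g M] at hB
    refine ⟨B, by rw [hcB, hc]; ring, hB.trans (Icc_subset_Icc_right ?_), by convert hsB using 1; ring⟩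
    have := hmin (M + 1) (Finset.mem_range.2 (by omega))
    linarith

open Dynamics in
theorem mul_log_two_le (h : IsFold f g) (M : ℕ) :
    (M : EReal) * ENNReal.log 2 ≤ ((M + 1 : ℕ) : EReal) * coverEntropy f (Icc 0 1) := by
  obtain ⟨ε, hε, hsep⟩ := h.exists_separated M
  set U : SetRel ℝ ℝ := {p | dist p.1 p.2 < ε / 2}
  have hmono : Monotone fun n ↦ ((netMaxcard f (Icc 0 1) U n : ℕ∞) : ENNReal) :=
    fun _ _ hmn ↦ ENat.toENNReal_mono (netMaxcard_monotone_time f (Icc 0 1) U hmn)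
  have hcomp := hmono.expGrowthSup_comp_mul (Nat.succ_ne_zero M)
  have hle : netEntropyEntourage f (Icc 0 1) U ≤ coverEntropy f (Icc 0 1) :=
    netEntropyEntourage_le_coverEntropy f (Icc 0 1) (Metric.dist_mem_uniformity (half_pos hε))
  calc (M : EReal) * ENNReal.log 2
      = ExpGrowth.expGrowthSup (fun k ↦ ((2 : ENNReal) ^ M) ^ k) := by
        rw [ExpGrowth.expGrowthSup_pow, ENNReal.log_pow]
    _ ≤ ExpGrowth.expGrowthSup
          ((fun n ↦ ((netMaxcard f (Icc 0 1) U n : ℕ∞) : ENNReal)) ∘ fun k ↦ (M + 1) * k) := by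
        refine ExpGrowth.expGrowthSup_monotone fun k ↦ ?_
        obtain ⟨A, hc, hA, hs⟩ := hsep k
        have := ENat.toENNReal_mono (hs.card_le_netMaxcard hA)
        rw [hc] at this
        simpa using this
    _ = ((M + 1 : ℕ) : EReal) * netEntropyEntourage f (Icc 0 1) U := hcomp
    _ ≤ _ := by gcongr

open Dynamics in
theorem coverEntropy_eq (h : IsFold f g) : coverEntropy f (Icc 0 1) = (Real.log 2 : EReal) := by
  have hlog : ENNReal.log 2 = (Real.log 2 : EReal) := by
    simpa using ENNReal.log_ofReal_of_pos (zero_lt_two (α := ℝ))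
  have hle := h.coverEntropy_le
  have hge := h.mul_log_two_le
  have h0 : 0 ≤ coverEntropy f (Icc 0 1) := coverEntropy_nonneg f ⟨0, by simp⟩
  rw [hlog] at hle hge
  refine le_antisymm hle ?_
  generalize coverEntropy f (Icc 0 1) = H at hle hge h0
  lift H to ℝ using ⟨ne_top_of_le_ne_top (EReal.coe_ne_top _) hle,
    ne_bot_of_le_ne_bot (by simp) h0⟩
  norm_cast at hge ⊢
  by_contra! hlt
  obtain ⟨M, hM⟩ := exists_nat_gt (H / (Real.log 2 - H))
  rw [div_lt_iff₀ (by linarith)] at hM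
  have := hge M
  push_cast at this
  linarith

end IsFold

theorem phi_strictMono {q : ℝ} (hq : 0 < q) (hq1 : q ≠ 1) : StrictMono (phi q) := by
  intro x y hxy
  unfold phi
  rcases lt_or_gt_of_ne hq1 with h | h
  · have := Real.rpow_lt_rpow_of_exponent_gt hq h hxy
    have h1 : 0 < 1 - q := by linarith
    gcongr
  · have := Real.rpow_lt_rpow_of_exponent_lt h hxy
    rw [← neg_div_neg_eq, ← neg_div_neg_eq (1 - q ^ y)]
    have h1 : 0 < -(1 - q) := by linarith
    gcongr

theorem phi_continuous {q : ℝ} (hq : 0 < q) : Continuous (phi q) := by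
  unfold phi
  exact (continuous_const.sub (Real.continuous_const_rpow hq.ne')).div_const _

theorem logistic_strictMonoOn : StrictMonoOn (logistic 4) (Icc 0 (1 / 2)) := by
  intro x hx y hy hxy
  unfold logistic
  nlinarith [hx.2, hy.2]

/-- For every `q ∈ (0,∞)` with `q ≠ 1`, the topological entropy of the q-deformed
logistic map `Φ_{q,4} : [0,1] → [0,1]` equals `log 2`. -/
theorem stmt_17 (q : ℝ) (hq : 0 < q) (hq1 : q ≠ 1) :
    Dynamics.coverEntropy (Phi q 4) (Set.Icc 0 1) = (Real.log 2 : EReal) := by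
  have hcont : Continuous (Phi q 4) :=
    (phi_continuous hq).comp (by unfold logistic; fun_prop)
  obtain ⟨g, hg⟩ := exists_isFold (f := Phi q 4) hcont.continuousOn
    (fun x ↦ by unfold Phi logistic; ring_nf)
    (fun x hx y hy hxy ↦ phi_strictMono hq hq1 (logistic_strictMonoOn hx hy hxy))
    (by simp [Phi, logistic, phi])
    (by
      have : logistic 4 (1 / 2) = 1 := by norm_num [logistic]
      rw [Phi, this, phi, Real.rpow_one, div_self (sub_ne_zero.2 hq1.symm)])
  exact hg.coverEntropy_eq
end
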